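/- For all reals k, l > 0, the limit as ε → 0⁺ of (i k²/4)·∫_ε^{l−ε} [Υ_γ(x) − Υ_δ(x)] dx exists and equals −(i/4)·H₀⁽¹⁾(kl) + (i/(2kl))·H₁⁽¹⁾(kl) − 1/(π k² l²). -/

import Mathlib

open MeasureTheory Set Filter Topology Real intervalIntegral

/-- Bessel function of the first kind `J_n(x)` (integral representation). -/
noncomputable def besselJ (n : ℕ) (x : ℝ) : ℝ :=
  (1 / π) * ∫ τ in (0:ℝ)..π, Real.cos (n * τ - x * Real.sin τ)

/-- Bessel function of the second kind `Y_n(x)` (integral representation). -/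
noncomputable def besselY (n : ℕ) (x : ℝ) : ℝ :=
  (1 / π) * (∫ τ in (0:ℝ)..π, Real.sin (x * Real.sin τ - n * τ))
    - (1 / π) * ∫ t in Set.Ioi (0:ℝ),
        (Real.exp (n * t) + (-1 : ℝ) ^ n * Real.exp (-(n * t))) * Real.exp (-x * Real.sinh t)

/-- Hankel function of the first kind `H_n^{(1)}(x) = J_n(x) + i Y_n(x)`. -/
noncomputable def hankelH1 (n : ℕ) (x : ℝ) : ℂ :=
  (besselJ n x : ℂ) + Complex.I * (besselY n x : ℂ)

/-- Struve function `𝐇₀(x)`. -/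
noncomputable def struveH0 (x : ℝ) : ℝ :=
  (2 / π) * ∫ t in (0:ℝ)..1, Real.sin (x * t) / Real.sqrt (1 - t ^ 2)

/-- Struve function `𝐇₁(x)`. -/
noncomputable def struveH1 (x : ℝ) : ℝ :=
  (2 * x / π) * ∫ t in (0:ℝ)..1, Real.sqrt (1 - t ^ 2) * Real.sin (x * t)

/-- Struve function `𝐇₋₁(x) = 2/π − 𝐇₁(x)`. -/
noncomputable def struveHm1 (x : ℝ) : ℝ := 2 / π - struveH1 x

/-- `Υ_α(x) = (1/k)·[H₁⁽¹⁾(kx) + H₁⁽¹⁾(k(l−x))]`. -/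
noncomputable def upsAlpha (k l x : ℝ) : ℂ :=
  ((1 / k : ℝ) : ℂ) * (hankelH1 1 (k * x) + hankelH1 1 (k * (l - x)))

/-- `Υ_β(x) = (x/l)·Υ_α(x)`. -/
noncomputable def upsBeta (k l x : ℝ) : ℂ := ((x / l : ℝ) : ℂ) * upsAlpha k l x

/-- `Υ_γ(x) = Υ_β(x) + (1/(k²l))·[k(l−x)·H₁⁽¹⁾(k(l−x)) − kx·H₁⁽¹⁾(kx)
  + H₀⁽¹⁾(k(l−x)) − H₀⁽¹⁾(kx)]`. -/
noncomputable def upsGamma (k l x : ℝ) : ℂ :=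
  upsBeta k l x + ((1 / (k ^ 2 * l) : ℝ) : ℂ) *
    (((k * (l - x) : ℝ) : ℂ) * hankelH1 1 (k * (l - x))
      - ((k * x : ℝ) : ℂ) * hankelH1 1 (k * x)
      + hankelH1 0 (k * (l - x)) - hankelH1 0 (k * x))

/-- `Υ_δ(x) = (x/l)·Υ_γ(x)`. -/
noncomputable def upsDelta (k l x : ℝ) : ℂ := ((x / l : ℝ) : ℂ) * upsGamma k l x

/-- Laplace-type moments `∫_0^∞ sinh^n t e^{-x sinh t} dt`. -/
noncomputable def auxM (n : ℕ) (x : ℝ) : ℝ :=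
  ∫ t in Set.Ioi (0:ℝ), Real.sinh t ^ n * Real.exp (-x * Real.sinh t)

/-- `∫_0^π sin^n τ cos (x sin τ) dτ`. -/
noncomputable def auxC (n : ℕ) (x : ℝ) : ℝ :=
  ∫ τ in (0:ℝ)..π, Real.sin τ ^ n * Real.cos (x * Real.sin τ)

/-- `∫_0^π sin^n τ sin (x sin τ) dτ`. -/
noncomputable def auxS (n : ℕ) (x : ℝ) : ℝ :=
  ∫ τ in (0:ℝ)..π, Real.sin τ ^ n * Real.sin (x * Real.sin τ)

lemma aux_pow_sin_le (n : ℕ) (t : ℝ) : |Real.sin t ^ n| ≤ 1 := by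
  rw [abs_pow]
  exact pow_le_one₀ (abs_nonneg _) (Real.abs_sin_le_one t)

lemma auxC_hasDerivAt (n : ℕ) (x : ℝ) : HasDerivAt (auxC n) (-auxS (n + 1) x) x := by
  have h := (intervalIntegral.hasDerivAt_integral_of_dominated_loc_of_deriv_le
    (μ := volume) (a := 0) (b := π) (bound := fun _ => (1:ℝ))
    (F := fun (x τ : ℝ) => Real.sin τ ^ n * Real.cos (x * Real.sin τ))
    (F' := fun (x τ : ℝ) => -(Real.sin τ ^ (n + 1) * Real.sin (x * Real.sin τ)))
    (x₀ := x) (s := Set.univ) Filter.univ_mem ?_ ?_ ?_ ?_ ?_ ?_).2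
  · rw [intervalIntegral.integral_neg] at h
    exact h
  · refine Eventually.of_forall fun y => Continuous.aestronglyMeasurable (by fun_prop)
  · exact Continuous.intervalIntegrable (by fun_prop) _ _
  · exact Continuous.aestronglyMeasurable (by fun_prop)
  · refine Eventually.of_forall fun t _ y _ => ?_
    rw [norm_neg, Real.norm_eq_abs, abs_mul]
    exact mul_le_one₀ (aux_pow_sin_le _ _) (abs_nonneg _) (Real.abs_sin_le_one _)
  · exact Continuous.intervalIntegrable (by fun_prop) _ _
  · refine Eventually.of_forall fun t _ y _ => ?_
    have h1 : HasDerivAt (fun y : ℝ => y * Real.sin t) (Real.sin t) y := by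
      simpa using (hasDerivAt_id y).mul_const (Real.sin t)
    have := (h1.cos).const_mul (Real.sin t ^ n)
    refine HasDerivAt.congr_deriv (this) ?_
    ring

lemma auxS_hasDerivAt (n : ℕ) (x : ℝ) : HasDerivAt (auxS n) (auxC (n + 1) x) x := by
  refine (intervalIntegral.hasDerivAt_integral_of_dominated_loc_of_deriv_le
    (μ := volume) (a := 0) (b := π) (bound := fun _ => (1:ℝ))
    (F := fun (x τ : ℝ) => Real.sin τ ^ n * Real.sin (x * Real.sin τ))
    (F' := fun (x τ : ℝ) => (Real.sin τ ^ (n + 1) * Real.cos (x * Real.sin τ)))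
    (x₀ := x) (s := Set.univ) Filter.univ_mem ?_ ?_ ?_ ?_ ?_ ?_).2
  · refine Eventually.of_forall fun y => Continuous.aestronglyMeasurable (by fun_prop)
  · exact Continuous.intervalIntegrable (by fun_prop) _ _
  · exact Continuous.aestronglyMeasurable (by fun_prop)
  · refine Eventually.of_forall fun t _ y _ => ?_
    rw [Real.norm_eq_abs, abs_mul]
    exact mul_le_one₀ (aux_pow_sin_le _ _) (abs_nonneg _) (Real.abs_cos_le_one _)
  · exact Continuous.intervalIntegrable (by fun_prop) _ _
  · refine Eventually.of_forall fun t _ y _ => ?_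
    have h1 : HasDerivAt (fun y : ℝ => y * Real.sin t) (Real.sin t) y := by
      simpa using (hasDerivAt_id y).mul_const (Real.sin t)
    have := (h1.sin).const_mul (Real.sin t ^ n)
    refine HasDerivAt.congr_deriv (this) ?_
    ring

lemma aux_xsin (x t : ℝ) :
    HasDerivAt (fun t : ℝ => x * Real.sin t) (x * Real.cos t) t :=
  (Real.hasDerivAt_sin t).const_mul x

lemma auxC_rec (x : ℝ) : x * (auxC 0 x - auxC 2 x) = auxS 1 x := by
  have key : ∫ τ in (0:ℝ)..π, (x * (Real.sin τ ^ 0 * Real.cos (x * Real.sin τ)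
      - Real.sin τ ^ 2 * Real.cos (x * Real.sin τ))
      - Real.sin τ ^ 1 * Real.sin (x * Real.sin τ)) = 0 := by
    rw [intervalIntegral.integral_eq_sub_of_hasDerivAt
      (f := fun τ => Real.cos τ * Real.sin (x * Real.sin τ))]
    · simp
    · intro t _
      refine HasDerivAt.congr_deriv ((Real.hasDerivAt_cos t).mul (aux_xsin x t).sin) ?_
      have := Real.sin_sq_add_cos_sq t
      have h2 : Real.sin t ^ 2 = 1 - Real.cos t ^ 2 := by linarith
      rw [h2]; ring
    · exact Continuous.intervalIntegrable (by fun_prop) _ _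
  rw [intervalIntegral.integral_sub, intervalIntegral.integral_const_mul,
    intervalIntegral.integral_sub] at key
  · unfold auxC auxS; linarith
  all_goals exact Continuous.intervalIntegrable (by fun_prop) _ _

lemma auxS_rec (x : ℝ) : x * (auxS 0 x - auxS 2 x) = 2 - auxC 1 x := by
  have key : ∫ τ in (0:ℝ)..π, (x * (Real.sin τ ^ 0 * Real.sin (x * Real.sin τ)
      - Real.sin τ ^ 2 * Real.sin (x * Real.sin τ))
      + Real.sin τ ^ 1 * Real.cos (x * Real.sin τ)) = 2 := by
    rw [intervalIntegral.integral_eq_sub_of_hasDerivAt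
      (f := fun τ => -(Real.cos τ * Real.cos (x * Real.sin τ)))]
    · simp; norm_num
    · intro t _
      refine HasDerivAt.congr_deriv (((Real.hasDerivAt_cos t).mul (aux_xsin x t).cos).neg) ?_
      have := Real.sin_sq_add_cos_sq t
      have h2 : Real.sin t ^ 2 = 1 - Real.cos t ^ 2 := by linarith
      rw [h2]; ring
    · exact Continuous.intervalIntegrable (by fun_prop) _ _
  rw [intervalIntegral.integral_add, intervalIntegral.integral_const_mul,
    intervalIntegral.integral_sub] at key
  · unfold auxC auxS; linarith
  all_goals exact Continuous.intervalIntegrable (by fun_prop) _ _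

lemma auxJ0 (x : ℝ) : besselJ 0 x = (1 / π) * auxC 0 x := by
  simp [besselJ, auxC]

lemma auxJ1 (x : ℝ) (hx : x ≠ 0) : besselJ 1 x = (1 / π) * auxS 1 x := by
  have key : ∫ τ in (0:ℝ)..π, (x * (Real.cos τ * Real.cos (x * Real.sin τ))) = 0 := by
    rw [intervalIntegral.integral_eq_sub_of_hasDerivAt
      (f := fun τ => Real.sin (x * Real.sin τ))]
    · simp
    · intro t _
      refine HasDerivAt.congr_deriv ((aux_xsin x t).sin) ?_
      ring
    · exact Continuous.intervalIntegrable (by fun_prop) _ _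
  rw [intervalIntegral.integral_const_mul] at key
  have key := (mul_eq_zero.mp key).resolve_left hx
  have e : ∀ τ : ℝ, Real.cos ((1:ℕ) * τ - x * Real.sin τ) =
      Real.cos τ * Real.cos (x * Real.sin τ) + Real.sin τ ^ 1 * Real.sin (x * Real.sin τ) := by
    intro τ; rw [Real.cos_sub]; simp
  unfold besselJ auxS
  simp_rw [e]
  rw [intervalIntegral.integral_add, key, zero_add]
  all_goals exact Continuous.intervalIntegrable (by fun_prop) _ _

lemma auxY0 (x : ℝ) : besselY 0 x = (1 / π) * auxS 0 x - (2 / π) * auxM 0 x := by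
  unfold besselY auxS auxM
  simp only [Nat.cast_zero, zero_mul, sub_zero, neg_zero, Real.exp_zero, pow_zero, one_mul]
  rw [MeasureTheory.integral_const_mul]
  ring

lemma auxY1 (x : ℝ) (hx : x ≠ 0) :
    besselY 1 x = -(1 / π) * auxC 1 x - (2 / π) * auxM 1 x := by
  have key : ∫ τ in (0:ℝ)..π, (x * (Real.cos τ * Real.sin (x * Real.sin τ))) = 0 := by
    rw [intervalIntegral.integral_eq_sub_of_hasDerivAt
      (f := fun τ => -Real.cos (x * Real.sin τ))]
    · simp
    · intro t _
      refine HasDerivAt.congr_deriv ((aux_xsin x t).cos.neg) ?_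
      ring
    · exact Continuous.intervalIntegrable (by fun_prop) _ _
  rw [intervalIntegral.integral_const_mul] at key
  have key := (mul_eq_zero.mp key).resolve_left hx
  have e : ∀ τ : ℝ, Real.sin (x * Real.sin τ - (1:ℕ) * τ) =
      Real.cos τ * Real.sin (x * Real.sin τ) - Real.sin τ ^ 1 * Real.cos (x * Real.sin τ) := by
    intro τ; rw [Real.sin_sub]; simp; ring
  have e2 : ∀ t : ℝ, (Real.exp ((1:ℕ) * t) + (-1 : ℝ) ^ 1 * Real.exp (-((1:ℕ) * t)))
      * Real.exp (-x * Real.sinh t) = 2 * (Real.sinh t ^ 1 * Real.exp (-x * Real.sinh t)) := by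
    intro t; rw [pow_one, Real.sinh_eq]; simp; ring
  unfold besselY auxC auxM
  simp_rw [e, e2]
  rw [intervalIntegral.integral_sub, key, MeasureTheory.integral_const_mul]
  · ring
  all_goals exact Continuous.intervalIntegrable (by fun_prop) _ _

lemma aux_tendsto_sinh : Tendsto Real.sinh atTop atTop :=
  tendsto_atTop_mono' _ ((eventually_ge_atTop 0).mono fun t ht => Real.self_le_sinh_iff.2 ht)
    tendsto_id

lemma aux_xsinh (x t : ℝ) :
    HasDerivAt (fun t : ℝ => Real.exp (-x * Real.sinh t))
      (Real.exp (-x * Real.sinh t) * (-x * Real.cosh t)) t :=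
  ((Real.hasDerivAt_sinh t).const_mul (-x)).exp

lemma aux_tendsto_exp (x : ℝ) (hx : 0 < x) :
    Tendsto (fun t => Real.exp (-x * Real.sinh t)) atTop (𝓝 0) := by
  refine Real.tendsto_exp_atBot.comp ?_
  exact aux_tendsto_sinh.const_mul_atTop_of_neg (by linarith)

lemma aux_cosh_facts (x : ℝ) (hx : 0 < x) :
    IntegrableOn (fun t => x * (Real.cosh t * Real.exp (-x * Real.sinh t))) (Ioi 0) ∧
    ∫ t in Ioi (0:ℝ), x * (Real.cosh t * Real.exp (-x * Real.sinh t)) = 1 := by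
  have hd : ∀ t ∈ Ioi (0:ℝ), HasDerivAt (fun t => -Real.exp (-x * Real.sinh t))
      (x * (Real.cosh t * Real.exp (-x * Real.sinh t))) t := by
    intro t _
    refine HasDerivAt.congr_deriv ((aux_xsinh x t).neg) ?_
    ring
  have hc : ContinuousWithinAt (fun t => -Real.exp (-x * Real.sinh t)) (Ici 0) 0 :=
    Continuous.continuousWithinAt (by fun_prop)
  have hn : ∀ t ∈ Ioi (0:ℝ), 0 ≤ x * (Real.cosh t * Real.exp (-x * Real.sinh t)) := by
    intro t _
    have := Real.cosh_pos t
    positivity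
  have ht : Tendsto (fun t => -Real.exp (-x * Real.sinh t)) atTop (𝓝 0) := by
    simpa using (aux_tendsto_exp x hx).neg
  refine ⟨integrableOn_Ioi_deriv_of_nonneg hc hd hn ht, ?_⟩
  rw [integral_Ioi_of_hasDerivAt_of_nonneg hc hd hn ht]
  simp

lemma aux_cosh_int (x : ℝ) (hx : 0 < x) :
    IntegrableOn (fun t => Real.cosh t * Real.exp (-x * Real.sinh t)) (Ioi 0) := by
  have := (aux_cosh_facts x hx).1.const_mul (x⁻¹)
  refine this.congr (Eventually.of_forall fun t => ?_)
  simp only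
  field_simp

lemma aux_pow_exp (n : ℕ) (c u : ℝ) (hc : 0 < c) (hu : 0 ≤ u) :
    u ^ n * Real.exp (-c * u) ≤ n.factorial / c ^ n := by
  have h := Real.pow_div_factorial_le_exp (c * u) (by positivity) n
  rw [mul_pow, div_le_iff₀ (by positivity)] at h
  rw [neg_mul, Real.exp_neg, ← div_eq_mul_inv, div_le_div_iff₀ (Real.exp_pos _) (by positivity)]
  linarith

lemma auxM_int (n : ℕ) (x : ℝ) (hx : 0 < x) :
    IntegrableOn (fun t => Real.sinh t ^ n * Real.exp (-x * Real.sinh t)) (Ioi 0) := by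
  have h := (aux_cosh_int (x / 2) (by positivity)).const_mul (n.factorial / (x / 2) ^ n : ℝ)
  refine Integrable.mono' h (Continuous.aestronglyMeasurable (by fun_prop)) ?_
  refine (ae_restrict_mem measurableSet_Ioi).mono fun t ht => ?_
  have hs : 0 ≤ Real.sinh t := Real.sinh_nonneg_iff.2 (le_of_lt ht)
  rw [Real.norm_eq_abs, abs_of_nonneg (by positivity)]
  have h1 := aux_pow_exp n (x / 2) (Real.sinh t) (by positivity) hs
  have e : Real.exp (-x * Real.sinh t) =
      Real.exp (-(x / 2) * Real.sinh t) * Real.exp (-(x / 2) * Real.sinh t) := by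
    rw [← Real.exp_add]; ring_nf
  rw [e, ← mul_assoc]
  refine mul_le_mul h1 ?_ (Real.exp_pos _).le (by positivity)
  exact le_mul_of_one_le_left (Real.exp_pos _).le (Real.one_le_cosh t)

lemma auxM_hasDerivAt (n : ℕ) (x : ℝ) (hx : 0 < x) :
    HasDerivAt (auxM n) (-auxM (n + 1) x) x := by
  have h := (_root_.hasDerivAt_integral_of_dominated_loc_of_deriv_le
    (μ := volume.restrict (Ioi (0:ℝ)))
    (bound := fun t => Real.sinh t ^ (n + 1) * Real.exp (-(x / 2) * Real.sinh t))
    (F := fun (x t : ℝ) => Real.sinh t ^ n * Real.exp (-x * Real.sinh t))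
    (F' := fun (x t : ℝ) => -(Real.sinh t ^ (n + 1) * Real.exp (-x * Real.sinh t)))
    (x₀ := x) (s := Ioi (x / 2)) (Ioi_mem_nhds (by linarith)) ?_ ?_ ?_ ?_ ?_ ?_).2
  · rw [MeasureTheory.integral_neg] at h
    exact h
  · exact Eventually.of_forall fun y => Continuous.aestronglyMeasurable (by fun_prop)
  · exact auxM_int n x hx
  · exact Continuous.aestronglyMeasurable (by fun_prop)
  · refine (ae_restrict_mem measurableSet_Ioi).mono fun t ht y hy => ?_
    have hs : 0 ≤ Real.sinh t := Real.sinh_nonneg_iff.2 (le_of_lt ht)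
    rw [norm_neg, Real.norm_eq_abs, abs_of_nonneg (by positivity)]
    have hy : x / 2 ≤ y := le_of_lt hy
    gcongr
  · exact auxM_int (n + 1) (x / 2) (by positivity)
  · refine Eventually.of_forall fun t y _ => ?_
    have h1 : HasDerivAt (fun y : ℝ => -y * Real.sinh t) (-Real.sinh t) y := by
      simpa using ((hasDerivAt_id y).neg).mul_const (Real.sinh t)
    have := (h1.exp).const_mul (Real.sinh t ^ n)
    refine HasDerivAt.congr_deriv (this) ?_
    ring

lemma aux_tendsto_cosh_exp (x : ℝ) (hx : 0 < x) :
    Tendsto (fun t => Real.cosh t * Real.exp (-x * Real.sinh t)) atTop (𝓝 0) := by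
  have h1 : Tendsto (fun t => Real.exp (-x * Real.sinh t) +
      x⁻¹ * ((x * Real.sinh t) ^ 1 * Real.exp (-(x * Real.sinh t)))) atTop (𝓝 (0 + x⁻¹ * 0)) :=
    (aux_tendsto_exp x hx).add (((Real.tendsto_pow_mul_exp_neg_atTop_nhds_zero 1).comp
      (aux_tendsto_sinh.const_mul_atTop hx)).const_mul _)
  rw [mul_zero, add_zero] at h1
  refine squeeze_zero' (Eventually.of_forall fun t => ?_) ?_ h1
  · have := Real.cosh_pos t
    positivity
  · filter_upwards [eventually_ge_atTop 0] with t ht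
    have e : Real.cosh t = Real.sinh t + Real.exp (-t) := by
      rw [Real.cosh_eq, Real.sinh_eq]; ring
    have e1 : Real.exp (-t) ≤ 1 := Real.exp_le_one_iff.2 (by linarith)
    have e2 : x⁻¹ * ((x * Real.sinh t) ^ 1 * Real.exp (-(x * Real.sinh t))) =
      Real.sinh t * Real.exp (-x * Real.sinh t) := by
      rw [neg_mul]; field_simp
    rw [e2]
    nlinarith [Real.exp_pos (-x * Real.sinh t)]

lemma auxM_rec (x : ℝ) (hx : 0 < x) : x * (auxM 0 x + auxM 2 x) - auxM 1 x = 1 := by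
  have i0 := auxM_int 0 x hx
  have i1 := auxM_int 1 x hx
  have i2 := auxM_int 2 x hx
  have key : ∫ t in Ioi (0:ℝ), (x * (Real.sinh t ^ 0 * Real.exp (-x * Real.sinh t)
      + Real.sinh t ^ 2 * Real.exp (-x * Real.sinh t))
      - Real.sinh t ^ 1 * Real.exp (-x * Real.sinh t)) = 1 := by
    rw [integral_Ioi_of_hasDerivAt_of_tendsto
      (f := fun t => -(Real.cosh t * Real.exp (-x * Real.sinh t))) (m := 0)]
    · simp
    · exact Continuous.continuousWithinAt (by fun_prop)
    · intro t _
      refine HasDerivAt.congr_deriv (((Real.hasDerivAt_cosh t).mul (aux_xsinh x t)).neg) ?_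
      have h2 : Real.sinh t ^ 2 = Real.cosh t ^ 2 - 1 := by
        have := Real.cosh_sq t
        linarith
      rw [h2]; ring
    · exact ((i0.add i2).const_mul x).sub i1
    · simpa using (aux_tendsto_cosh_exp x hx).neg
  have i02 : IntegrableOn (fun t => x * (Real.sinh t ^ 0 * Real.exp (-x * Real.sinh t)
      + Real.sinh t ^ 2 * Real.exp (-x * Real.sinh t))) (Ioi 0) := (i0.add i2).const_mul x
  rw [MeasureTheory.integral_sub i02 i1, MeasureTheory.integral_const_mul,
    MeasureTheory.integral_add i0 i2] at key
  exact key

lemma auxM_nonneg (n : ℕ) (x : ℝ) : 0 ≤ auxM n x := by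
  refine setIntegral_nonneg measurableSet_Ioi fun t ht => ?_
  have hs : 0 ≤ Real.sinh t := Real.sinh_nonneg_iff.2 (le_of_lt ht)
  positivity

lemma auxM0_le (x : ℝ) (hx : 0 < x) : x * auxM 0 x ≤ 2 * Real.sqrt x := by
  have hs := Real.sqrt_pos.2 hx
  obtain ⟨hi, hv⟩ := aux_cosh_facts x hx
  have h2 := integrableOn_exp_neg_Ioi 0
  have : ∫ t in Ioi (0:ℝ), x * (Real.sinh t ^ 0 * Real.exp (-x * Real.sinh t)) ≤
      ∫ t in Ioi (0:ℝ), (Real.sqrt x * (x * (Real.cosh t * Real.exp (-x * Real.sinh t)))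
        + Real.sqrt x * Real.exp (-t)) := by
    refine setIntegral_mono_on ((auxM_int 0 x hx).const_mul x)
      ((hi.const_mul _).add (h2.const_mul _)) measurableSet_Ioi fun t ht => ?_
    have hsn : 0 ≤ Real.sinh t := Real.sinh_nonneg_iff.2 (le_of_lt ht)
    have e1 : Real.exp (-x * Real.sinh t) ≤ 1 :=
      Real.exp_le_one_iff.2 (by nlinarith)
    have e0 := Real.exp_pos (-x * Real.sinh t)
    set E := Real.exp (-x * Real.sinh t)
    set s := Real.sqrt x
    have hx2 : x = s ^ 2 := (Real.sq_sqrt hx.le).symm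
    have hc : Real.cosh t = (Real.exp t + Real.exp (-t)) / 2 := Real.cosh_eq t
    have hm : Real.exp t * Real.exp (-t) = 1 := by rw [← Real.exp_add]; simp
    have p1 := Real.exp_pos t
    have p2 := Real.exp_pos (-t)
    set a := Real.exp t
    set b := Real.exp (-t)
    rw [hx2, pow_zero, one_mul]
    have h3 : s ≤ s ^ 2 * (a / 2) + b := by
      have : s ^ 2 * a - 2 * s + b = b * (s * a - 1) ^ 2 := by
        linear_combination (-s ^ 2 * a + 2 * s) * hm
      have := mul_nonneg p2.le (sq_nonneg (s * a - 1))
      linarith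
    have h4 : s * E ≤ s ^ 2 * (Real.cosh t * E) + b := by
      have : s * E ≤ (s ^ 2 * (a / 2) + b) * E := by gcongr
      have : b * E ≤ b := mul_le_of_le_one_right p2.le e1
      have : 0 ≤ s ^ 2 * (b / 2) * E := by positivity
      rw [hc]
      nlinarith
    calc s ^ 2 * E = s * (s * E) := by ring
      _ ≤ s * (s ^ 2 * (Real.cosh t * E) + b) := by gcongr
      _ = _ := by ring
  rw [MeasureTheory.integral_const_mul, MeasureTheory.integral_add (hi.const_mul _)
    (h2.const_mul _), MeasureTheory.integral_const_mul,
    MeasureTheory.integral_const_mul (Real.sqrt x), hv,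
    integral_exp_neg_Ioi_zero] at this
  unfold auxM
  linarith

lemma auxM1_bounds (x : ℝ) (hx : 0 < x) : 1 - x ≤ x * auxM 1 x ∧ x * auxM 1 x ≤ 1 := by
  obtain ⟨hi, hv⟩ := aux_cosh_facts x hx
  have h2 := integrableOn_exp_neg_Ioi 0
  have hM : x * auxM 1 x =
      ∫ t in Ioi (0:ℝ), x * (Real.sinh t ^ 1 * Real.exp (-x * Real.sinh t)) := by
    rw [MeasureTheory.integral_const_mul]; rfl
  constructor
  · have : ∫ t in Ioi (0:ℝ), (x * (Real.cosh t * Real.exp (-x * Real.sinh t))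
        - x * Real.exp (-t)) ≤
        ∫ t in Ioi (0:ℝ), x * (Real.sinh t ^ 1 * Real.exp (-x * Real.sinh t)) := by
      refine setIntegral_mono_on (hi.sub (h2.const_mul _))
        ((auxM_int 1 x hx).const_mul x) measurableSet_Ioi fun t ht => ?_
      have hsn : 0 ≤ Real.sinh t := Real.sinh_nonneg_iff.2 (le_of_lt ht)
      have e1 : Real.exp (-x * Real.sinh t) ≤ 1 :=
        Real.exp_le_one_iff.2 (by nlinarith)
      have e : Real.cosh t = Real.sinh t + Real.exp (-t) := by
        rw [Real.cosh_eq, Real.sinh_eq]; ring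
      have : Real.exp (-t) * Real.exp (-x * Real.sinh t) ≤ Real.exp (-t) :=
        mul_le_of_le_one_right (Real.exp_pos _).le e1
      rw [e, pow_one, ← mul_sub]
      gcongr
      linarith
    rw [MeasureTheory.integral_sub hi (h2.const_mul _), hv, MeasureTheory.integral_const_mul,
      integral_exp_neg_Ioi_zero] at this
    rw [hM]; linarith
  · rw [hM, ← hv]
    refine setIntegral_mono_on ((auxM_int 1 x hx).const_mul x) hi measurableSet_Ioi fun t ht => ?_
    rw [pow_one]
    have := (Real.sinh_lt_cosh t).le
    gcongr

lemma besselJ0_hasDerivAt (x : ℝ) (hx : 0 < x) :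
    HasDerivAt (besselJ 0) (-besselJ 1 x) x := by
  have e : besselJ 0 = fun x => (1 / π) * auxC 0 x := funext auxJ0
  rw [e, auxJ1 x hx.ne']
  refine HasDerivAt.congr_deriv ((auxC_hasDerivAt 0 x).const_mul (1 / π)) ?_
  ring

lemma besselJ1_hasDerivAt (x : ℝ) (hx : 0 < x) :
    HasDerivAt (besselJ 1) (besselJ 0 x - besselJ 1 x / x) x := by
  have e : besselJ 1 =ᶠ[𝓝 x] fun x => (1 / π) * auxS 1 x := by
    filter_upwards [lt_mem_nhds hx] with y hy using auxJ1 y hy.ne'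
  refine HasDerivAt.congr_of_eventuallyEq ?_ e
  rw [auxJ0, auxJ1 x hx.ne', ← auxC_rec x]
  refine HasDerivAt.congr_deriv ((auxS_hasDerivAt 1 x).const_mul (1 / π)) ?_
  field_simp
  ring

lemma besselY0_hasDerivAt (x : ℝ) (hx : 0 < x) :
    HasDerivAt (besselY 0) (-besselY 1 x) x := by
  have e : besselY 0 = fun x => (1 / π) * auxS 0 x - (2 / π) * auxM 0 x := funext auxY0
  rw [e, auxY1 x hx.ne']
  refine HasDerivAt.congr_deriv (((auxS_hasDerivAt 0 x).const_mul (1 / π)).sub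
    ((auxM_hasDerivAt 0 x hx).const_mul (2 / π))) ?_
  ring

lemma besselY1_hasDerivAt (x : ℝ) (hx : 0 < x) :
    HasDerivAt (besselY 1) (besselY 0 x - besselY 1 x / x) x := by
  have e : besselY 1 =ᶠ[𝓝 x] fun x => -(1 / π) * auxC 1 x - (2 / π) * auxM 1 x := by
    filter_upwards [lt_mem_nhds hx] with y hy using auxY1 y hy.ne'
  refine HasDerivAt.congr_of_eventuallyEq ?_ e
  rw [auxY0, auxY1 x hx.ne']
  refine HasDerivAt.congr_deriv (((auxC_hasDerivAt 1 x).const_mul (-(1 / π))).sub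
    ((auxM_hasDerivAt 1 x hx).const_mul (2 / π))) ?_
  have h1 := auxS_rec x
  have h2 := auxM_rec x hx
  have hpi := Real.pi_pos.ne'
  field_simp
  have e11 : (1 + 1 : ℕ) = 2 := rfl
  rw [e11]
  linear_combination 2 * h2 - h1

lemma hankel_zero_hasDerivAt (x : ℝ) (hx : 0 < x) :
    HasDerivAt (hankelH1 0) (-hankelH1 1 x) x := by
  have h := ((besselJ0_hasDerivAt x hx).ofReal_comp).add
    (((besselY0_hasDerivAt x hx).ofReal_comp).const_mul Complex.I)
  refine HasDerivAt.congr_deriv (h) ?_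
  simp only [hankelH1]; push_cast; ring

lemma hankel_one_hasDerivAt (x : ℝ) (hx : 0 < x) :
    HasDerivAt (hankelH1 1) (hankelH1 0 x - hankelH1 1 x / x) x := by
  have h := ((besselJ1_hasDerivAt x hx).ofReal_comp).add
    (((besselY1_hasDerivAt x hx).ofReal_comp).const_mul Complex.I)
  refine HasDerivAt.congr_deriv (h) ?_
  simp only [hankelH1]; push_cast; ring

lemma aux_mul_tendsto (f : ℝ → ℝ) (hf : ContinuousAt f 0) :
    Tendsto (fun x => x * f x) (𝓝[>] 0) (𝓝 0) := by
  have : Tendsto (fun x => x * f x) (𝓝 0) (𝓝 (0 * f 0)) := tendsto_id.mul hf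
  rw [zero_mul] at this
  exact this.mono_left nhdsWithin_le_nhds

lemma mulH0_tendsto : Tendsto (fun x : ℝ => (x : ℂ) * hankelH1 0 x) (𝓝[>] 0) (𝓝 0) := by
  have hC := aux_mul_tendsto _ (auxC_hasDerivAt 0 0).continuousAt
  have hS := aux_mul_tendsto _ (auxS_hasDerivAt 0 0).continuousAt
  have hM : Tendsto (fun x => x * auxM 0 x) (𝓝[>] 0) (𝓝 0) := by
    have h : Tendsto (fun x => 2 * Real.sqrt x) (𝓝[>] 0) (𝓝 0) := by
      have : Tendsto (fun x => 2 * Real.sqrt x) (𝓝 0) (𝓝 (2 * Real.sqrt 0)) :=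
        (Continuous.tendsto (by fun_prop) 0)
      rw [Real.sqrt_zero, mul_zero] at this
      exact this.mono_left nhdsWithin_le_nhds
    refine squeeze_zero' ?_ ?_ h
    · filter_upwards [self_mem_nhdsWithin] with x hx
      exact mul_nonneg (le_of_lt hx) (auxM_nonneg 0 x)
    · filter_upwards [self_mem_nhdsWithin] with x hx using auxM0_le x hx
  have h := ((hC.const_mul (1 / π)).ofReal).add
    ((((hS.const_mul (1 / π)).sub (hM.const_mul (2 / π))).ofReal).const_mul Complex.I)
  simp only [mul_zero, sub_zero, Complex.ofReal_zero, add_zero] at h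
  refine h.congr fun x => ?_
  simp only [hankelH1, auxJ0, auxY0]
  push_cast
  ring

lemma mulH1_tendsto : Tendsto (fun x : ℝ => (x : ℂ) * hankelH1 1 x) (𝓝[>] 0)
    (𝓝 (-(2 / π) * Complex.I)) := by
  have hC := aux_mul_tendsto _ (auxC_hasDerivAt 1 0).continuousAt
  have hS := aux_mul_tendsto _ (auxS_hasDerivAt 1 0).continuousAt
  have hM : Tendsto (fun x => x * auxM 1 x) (𝓝[>] 0) (𝓝 1) := by
    have h : Tendsto (fun x : ℝ => 1 - x) (𝓝[>] 0) (𝓝 1) := by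
      have : Tendsto (fun x : ℝ => 1 - x) (𝓝 0) (𝓝 (1 - 0)) :=
        (Continuous.tendsto (by fun_prop) 0)
      rw [sub_zero] at this
      exact this.mono_left nhdsWithin_le_nhds
    refine tendsto_of_tendsto_of_tendsto_of_le_of_le' h tendsto_const_nhds ?_ ?_
    · filter_upwards [self_mem_nhdsWithin] with x hx using (auxM1_bounds x hx).1
    · filter_upwards [self_mem_nhdsWithin] with x hx using (auxM1_bounds x hx).2
  have h := ((hS.const_mul (1 / π)).ofReal).add
    ((((hC.const_mul (-(1 / π))).sub (hM.const_mul (2 / π))).ofReal).const_mul Complex.I)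
  have e : (((1 / π * 0 : ℝ) : ℂ) + Complex.I * ((-(1 / π) * 0 - 2 / π * 1 : ℝ) : ℂ))
      = -(2 / π) * Complex.I := by
    simp; ring
  rw [e] at h
  refine h.congr' ?_
  filter_upwards [self_mem_nhdsWithin] with x hx
  have hx : x ≠ 0 := ne_of_gt hx
  simp only [hankelH1, auxJ1 x hx, auxY1 x hx]
  push_cast
  ring

lemma hankel_comp_zero (k y : ℝ) (hk : 0 < k) (hy : 0 < y) :
    HasDerivAt (fun y => hankelH1 0 (k * y)) (-(k * hankelH1 1 (k * y))) y := by
  have h := (hankel_zero_hasDerivAt (k * y) (by positivity)).scomp y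
    ((hasDerivAt_id y).const_mul k)
  refine HasDerivAt.congr_deriv (h) ?_
  simp

lemma hankel_comp_one (k y : ℝ) (hk : 0 < k) (hy : 0 < y) :
    HasDerivAt (fun y => hankelH1 1 (k * y))
      (k * (hankelH1 0 (k * y) - hankelH1 1 (k * y) / (k * y))) y := by
  have h := (hankel_one_hasDerivAt (k * y) (by positivity)).scomp y
    ((hasDerivAt_id y).const_mul k)
  refine HasDerivAt.congr_deriv (h) ?_
  simp

/-- the antiderivative -/
noncomputable def auxG (k l y : ℝ) : ℂ :=
  -(y * hankelH1 0 (k * y)) / (l * k ^ 2) + 2 * (y * hankelH1 1 (k * y)) / (k ^ 3 * l ^ 2)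

/-- its derivative -/
noncomputable def auxg (k l y : ℝ) : ℂ :=
  y * hankelH1 1 (k * y) / (l * k) - hankelH1 0 (k * y) / (k ^ 2 * l)
    + 2 * y * hankelH1 0 (k * y) / (k ^ 2 * l ^ 2)

lemma auxG_hasDerivAt (k l y : ℝ) (hk : 0 < k) (hl : 0 < l) (hy : 0 < y) :
    HasDerivAt (auxG k l) (auxg k l y) y := by
  have hid : HasDerivAt (fun y : ℝ => (y : ℂ)) 1 y := Complex.ofRealCLM.hasDerivAt
  have h0 := hid.mul (hankel_comp_zero k y hk hy)
  have h1 := hid.mul (hankel_comp_one k y hk hy)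
  have h := (h0.neg.div_const ((l : ℂ) * k ^ 2)).add
    ((h1.const_mul 2).div_const ((k : ℂ) ^ 3 * l ^ 2))
  refine HasDerivAt.congr_deriv (h) ?_
  have hk' : (k : ℂ) ≠ 0 := by exact_mod_cast hk.ne'
  have hl' : (l : ℂ) ≠ 0 := by exact_mod_cast hl.ne'
  have hy' : (y : ℂ) ≠ 0 := by exact_mod_cast hy.ne'
  unfold auxg
  field_simp
  ring

lemma ups_simp (k l x : ℝ) (hk : 0 < k) (hl : 0 < l) :
    upsGamma k l x - upsDelta k l x =
      ((l - x : ℝ) : ℂ) * hankelH1 1 (k * (l - x)) / (l * k)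
      + ((l - x : ℝ) : ℂ) * hankelH1 0 (k * (l - x)) / (k ^ 2 * l ^ 2)
      - ((l - x : ℝ) : ℂ) * hankelH1 0 (k * x) / (k ^ 2 * l ^ 2) := by
  have hk' : (k : ℂ) ≠ 0 := by exact_mod_cast hk.ne'
  have hl' : (l : ℂ) ≠ 0 := by exact_mod_cast hl.ne'
  unfold upsDelta upsGamma upsBeta upsAlpha
  push_cast
  field_simp
  ring

lemma ups_integral (k l ε : ℝ) (hk : 0 < k) (hl : 0 < l) (hε : 0 < ε) (hεl : ε < l / 2) :
    ∫ x in ε..(l - ε), (upsGamma k l x - upsDelta k l x) = auxG k l (l - ε) - auxG k l ε := by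
  have hle : ε ≤ l - ε := by linarith
  have c0 : ContinuousOn (fun y => hankelH1 0 (k * y)) (uIcc ε (l - ε)) := fun y hy => by
    rw [uIcc_of_le hle] at hy
    exact (hankel_comp_zero k y hk (by linarith [hy.1])).continuousAt.continuousWithinAt
  have c1 : ContinuousOn (fun y => hankelH1 1 (k * y)) (uIcc ε (l - ε)) := fun y hy => by
    rw [uIcc_of_le hle] at hy
    exact (hankel_comp_one k y hk (by linarith [hy.1])).continuousAt.continuousWithinAt
  have cy : ContinuousOn (fun y : ℝ => (y : ℂ)) (uIcc ε (l - ε)) :=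
    Complex.continuous_ofReal.continuousOn
  let A : ℝ → ℂ := fun y => (y : ℂ) * hankelH1 1 (k * y) / (l * k)
      + (y : ℂ) * hankelH1 0 (k * y) / (k ^ 2 * l ^ 2)
  let B : ℝ → ℂ := fun y => ((l - y : ℝ) : ℂ) * hankelH1 0 (k * y) / (k ^ 2 * l ^ 2)
  have cA : ContinuousOn A (uIcc ε (l - ε)) :=
    ((cy.mul c1).div_const _).add ((cy.mul c0).div_const _)
  have cB : ContinuousOn B (uIcc ε (l - ε)) := by
    have : ContinuousOn (fun y : ℝ => ((l - y : ℝ) : ℂ)) (uIcc ε (l - ε)) :=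
      Continuous.continuousOn (by fun_prop)
    exact (this.mul c0).div_const _
  have iA : IntervalIntegrable A volume ε (l - ε) := cA.intervalIntegrable
  have iB : IntervalIntegrable B volume ε (l - ε) := cB.intervalIntegrable
  have iA' : IntervalIntegrable (fun x => A (l - x)) volume ε (l - ε) := by
    refine ContinuousOn.intervalIntegrable (cA.comp (by fun_prop) fun y hy => ?_)
    rw [uIcc_of_le hle] at hy ⊢
    exact ⟨by linarith [hy.2], by linarith [hy.1]⟩
  have e1 : ∀ x, upsGamma k l x - upsDelta k l x = A (l - x) - B x := fun x => by
    rw [ups_simp k l x hk hl]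
  have e2 : ∀ x, A x - B x = auxg k l x := fun x => by
    have hk' : (k : ℂ) ≠ 0 := by exact_mod_cast hk.ne'
    have hl' : (l : ℂ) ≠ 0 := by exact_mod_cast hl.ne'
    simp only [A, B, auxg]
    push_cast
    field_simp
    ring
  simp_rw [e1]
  rw [intervalIntegral.integral_sub iA' iB, intervalIntegral.integral_comp_sub_left A l,
    sub_sub_cancel, ← intervalIntegral.integral_sub iA iB]
  have iG : IntervalIntegrable (fun x => A x - B x) volume ε (l - ε) := iA.sub iB
  simp_rw [e2] at iG ⊢
  refine intervalIntegral.integral_eq_sub_of_hasDerivAt (fun y hy => ?_) iG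
  rw [uIcc_of_le hle] at hy
  exact auxG_hasDerivAt k l y hk hl (by linarith [hy.1])

lemma auxG_tendsto (k l : ℝ) (hk : 0 < k) (hl : 0 < l) :
    Tendsto (auxG k l) (𝓝[>] 0) (𝓝 (-(4 / (π * k ^ 4 * l ^ 2)) * Complex.I)) := by
  have hk' : (k : ℂ) ≠ 0 := by exact_mod_cast hk.ne'
  have hl' : (l : ℂ) ≠ 0 := by exact_mod_cast hl.ne'
  have hp' : (π : ℂ) ≠ 0 := by exact_mod_cast Real.pi_pos.ne'
  have hm : Tendsto (fun y : ℝ => k * y) (𝓝[>] 0) (𝓝[>] 0) := by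
    refine tendsto_nhdsWithin_iff.2 ⟨?_, ?_⟩
    · have : Tendsto (fun y : ℝ => k * y) (𝓝 0) (𝓝 (k * 0)) := Continuous.tendsto (by fun_prop) 0
      rw [mul_zero] at this
      exact this.mono_left nhdsWithin_le_nhds
    · filter_upwards [self_mem_nhdsWithin] with y hy
      exact mul_pos hk hy
  have h0 := (mulH0_tendsto.comp hm).neg.div_const ((l : ℂ) * k ^ 3)
  have h1 := ((mulH1_tendsto.comp hm).const_mul 2).div_const ((k : ℂ) ^ 4 * l ^ 2)
  have h := h0.add h1
  have e : -0 / ((l : ℂ) * k ^ 3) + 2 * (-(2 / π) * Complex.I) / ((k : ℂ) ^ 4 * l ^ 2) =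
      -(4 / (π * k ^ 4 * l ^ 2)) * Complex.I := by
    field_simp
    ring
  rw [e] at h
  refine h.congr fun y => ?_
  simp only [Function.comp, auxG]
  push_cast
  field_simp

/-- the limit as `ε → 0⁺` of `(ik²/4)·∫_ε^{l−ε} [Υ_γ − Υ_δ]` is
`−(i/4)·H₀⁽¹⁾(kl) + (i/(2kl))·H₁⁽¹⁾(kl) − 1/(πk²l²)`. -/
theorem statement17 (k l : ℝ) (hk : 0 < k) (hl : 0 < l) :
    Filter.Tendsto
      (fun ε : ℝ =>
        (Complex.I * (k : ℂ) ^ 2 / 4) *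
          ∫ x in ε..(l - ε), (upsGamma k l x - upsDelta k l x))
      (nhdsWithin 0 (Set.Ioi 0))
      (nhds (-(Complex.I / 4) * hankelH1 0 (k * l)
        + (Complex.I / (2 * (k : ℂ) * (l : ℂ))) * hankelH1 1 (k * l)
        - 1 / ((π : ℂ) * (k : ℂ) ^ 2 * (l : ℂ) ^ 2))) := by
  have hk' : (k : ℂ) ≠ 0 := by exact_mod_cast hk.ne'
  have hl' : (l : ℂ) ≠ 0 := by exact_mod_cast hl.ne'
  have hp' : (π : ℂ) ≠ 0 := by exact_mod_cast Real.pi_pos.ne'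
  have hG : Tendsto (fun ε => auxG k l (l - ε)) (𝓝[>] 0) (𝓝 (auxG k l l)) := by
    have h1 : Tendsto (fun ε : ℝ => l - ε) (𝓝 0) (𝓝 (l - 0)) := Continuous.tendsto (by fun_prop) 0
    rw [sub_zero] at h1
    exact ((auxG_hasDerivAt k l l hk hl hl).continuousAt.tendsto.comp h1).mono_left
      nhdsWithin_le_nhds
  have h := (hG.sub (auxG_tendsto k l hk hl)).const_mul (Complex.I * (k : ℂ) ^ 2 / 4)
  have e : Complex.I * (k : ℂ) ^ 2 / 4 *
      (auxG k l l - -(4 / (π * k ^ 4 * l ^ 2)) * Complex.I) =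
      (-(Complex.I / 4) * hankelH1 0 (k * l)
        + (Complex.I / (2 * (k : ℂ) * (l : ℂ))) * hankelH1 1 (k * l)
        - 1 / ((π : ℂ) * (k : ℂ) ^ 2 * (l : ℂ) ^ 2)) := by
    unfold auxG
    have hI : Complex.I ^ 2 = -1 := Complex.I_sq
    field_simp
    ring_nf
    simp only [hI]
    ring
  rw [e] at h
  refine h.congr' ?_
  filter_upwards [self_mem_nhdsWithin,
    mem_nhdsWithin_of_mem_nhds (gt_mem_nhds (by positivity : (0:ℝ) < l / 2))] with ε h1 h2
  rw [ups_integral k l ε hk hl h1 h2]
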